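/- arXiv:2311.16428 — 12 statements merged into one kernel-verified Lean document; each statement's English description precedes it below -/
import Mathlib

section
/- Let n ≥ 2 be an integer, let A be an n×n complex Hermitian matrix with trace zero, and let μ ∈ ℂⁿ. Then (Σ_{i,j=1}^n |A_{ij}|²) · ‖μ‖² ≥ (n/(n−1)) · Σ_{i=1}^n |Σ_{j=1}^n A_{ij} μ_j|², i.e. the squared Frobenius norm of A times ‖μ‖² is at least n/(n−1) times ‖Aμ‖². -/
open Matrix in
lemma aux_vec {n : ℕ} (v : Fin n → ℂ) : ((∑ i, ‖v i‖ ^ 2 : ℝ) : ℂ) = star v ⬝ᵥ v := by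
  simp [dotProduct, Complex.conj_mul']

open Matrix in
lemma aux_isom {n : ℕ} (U : Matrix (Fin n) (Fin n) ℂ) (hU : Uᴴ * U = 1) (v : Fin n → ℂ) :
    ∑ i, ‖(U *ᵥ v) i‖ ^ 2 = ∑ i, ‖v i‖ ^ 2 := by
  have h : ((∑ i, ‖(U *ᵥ v) i‖ ^ 2 : ℝ) : ℂ) = ((∑ i, ‖v i‖ ^ 2 : ℝ) : ℂ) := by
    rw [aux_vec, aux_vec, star_mulVec, ← dotProduct_mulVec, mulVec_mulVec, hU, one_mulVec]
  exact_mod_cast h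

open Matrix in
lemma aux_frob {n : ℕ} (A : Matrix (Fin n) (Fin n) ℂ) :
    ((∑ i, ∑ j, ‖A i j‖ ^ 2 : ℝ) : ℂ) = (A * Aᴴ).trace := by
  simp [Matrix.trace, Matrix.mul_apply, Complex.mul_conj']

lemma aux_real {n : ℕ} (l : Fin n → ℝ) (h : ∑ i, l i = 0) (i : Fin n) :
    (n : ℝ) * l i ^ 2 ≤ ((n : ℝ) - 1) * ∑ j, l j ^ 2 := by
  have h1 := Finset.add_sum_erase Finset.univ l (Finset.mem_univ i)
  have h2 := Finset.add_sum_erase Finset.univ (fun j => l j ^ 2) (Finset.mem_univ i)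
  have h3 := sq_sum_le_card_mul_sum_sq (s := Finset.univ.erase i) (f := l)
  have h4 : (((Finset.univ.erase i).card : ℕ) : ℝ) = n - 1 := by
    rw [Finset.card_erase_of_mem (Finset.mem_univ i), Finset.card_univ, Fintype.card_fin,
      Nat.cast_sub (by have := i.2; omega)]
    simp
  rw [h4] at h3
  have h5 : ∑ j ∈ Finset.univ.erase i, l j = - l i := by linarith
  rw [h5] at h3
  rw [← h2]
  linarith

open Matrix in
theorem frobenius_bound_traceless_hermitian (n : ℕ) (hn : 2 ≤ n)
    (A : Matrix (Fin n) (Fin n) ℂ) (hA : A.IsHermitian) (htr : A.trace = 0)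
    (μ : Fin n → ℂ) :
    (∑ i, ∑ j, ‖A i j‖ ^ 2) * ∑ j, ‖μ j‖ ^ 2 ≥
      ((n : ℝ) / (n - 1)) * ∑ i, ‖∑ j, A i j * μ j‖ ^ 2 := by
  obtain ⟨U, l, hU, hU', hAU⟩ : ∃ (U : Matrix (Fin n) (Fin n) ℂ) (l : Fin n → ℝ),
      Uᴴ * U = 1 ∧ U * Uᴴ = 1 ∧ A = U * diagonal (fun i => (l i : ℂ)) * Uᴴ := by
    refine ⟨hA.eigenvectorUnitary, hA.eigenvalues, ?_, ?_, ?_⟩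
    · exact Unitary.coe_star_mul_self hA.eigenvectorUnitary
    · exact Unitary.coe_mul_star_self hA.eigenvectorUnitary
    · have := hA.spectral_theorem
      rw [Unitary.conjStarAlgAut_apply] at this
      exact this
  have hl : ∑ i, l i = 0 := by
    rw [hAU, trace_mul_comm, ← mul_assoc, hU, one_mul, trace_diagonal] at htr
    exact_mod_cast htr
  have hF : ∑ i, ∑ j, ‖A i j‖ ^ 2 = ∑ i, l i ^ 2 := by
    have h : ((∑ i, ∑ j, ‖A i j‖ ^ 2 : ℝ) : ℂ) = ((∑ i, l i ^ 2 : ℝ) : ℂ) := by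
      have e : A * A = U * (diagonal (fun i => (l i : ℂ)) * diagonal (fun i => (l i : ℂ))) * Uᴴ := by
        calc A * A = U * diagonal (fun i => (l i : ℂ)) * (Uᴴ * U)
              * diagonal (fun i => (l i : ℂ)) * Uᴴ := by
              rw [hAU]; simp only [mul_assoc]
          _ = _ := by rw [hU]; simp only [mul_assoc, one_mul]
      rw [aux_frob, hA.eq, e, trace_mul_comm, ← mul_assoc, hU, one_mul, diagonal_mul_diagonal,
        trace_diagonal]
      push_cast
      simp only [sq]
    exact_mod_cast h
  set ν := Uᴴ *ᵥ μ with hν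
  have hm : ∑ j, ‖μ j‖ ^ 2 = ∑ j, ‖ν j‖ ^ 2 :=
    (aux_isom Uᴴ (by rw [conjTranspose_conjTranspose, hU']) μ).symm
  have hAm : ∑ i, ‖∑ j, A i j * μ j‖ ^ 2 = ∑ i, l i ^ 2 * ‖ν i‖ ^ 2 := by
    have e : A *ᵥ μ = U *ᵥ (diagonal (fun i => (l i : ℂ)) *ᵥ ν) := by
      rw [hν, mulVec_mulVec, mulVec_mulVec, ← hAU]
    change ∑ i, ‖(A *ᵥ μ) i‖ ^ 2 = _
    rw [e, aux_isom U hU]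
    simp [mulVec_diagonal, mul_pow]
  have hn1 : (0 : ℝ) < n - 1 := by
    have : (2 : ℝ) ≤ n := by exact_mod_cast hn
    linarith
  rw [hF, hm, hAm, ge_iff_le, div_mul_eq_mul_div, div_le_iff₀ hn1, Finset.mul_sum,
    Finset.mul_sum, Finset.sum_mul]
  refine Finset.sum_le_sum fun i _ => ?_
  have := mul_le_mul_of_nonneg_right (aux_real l hl i) (sq_nonneg ‖ν i‖)
  linarith
end

section
/- Let n ≥ 1 be an integer and let α be a real number with 2n(n+2)/(2n²+1) ≤ α < (n+2)/n. Then f₁(α) > 0, where f₁(α) = (n(10n⁴+35n³+44n²+16n−6)/(n+2)²)·α³ − ((22n⁴+57n³+46n²−8)/(n+2))·α² + (14n³+25n²+8n−8)·α − (n+2)²(2n−1). -/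
theorem f1_aux (m u : ℝ) (hm : 1 ≤ m) (hu : 0 < u) (hu2 : u * (2 * m ^ 2 + 1) ≤ 1) :
    0 < (8*m^2+8*m+2) - (16*m^3+48*m^2+40*m-2)*u + (8*m^4+48*m^3+86*m^2+48*m-10)*u^2
      - (10*m^4+35*m^3+44*m^2+16*m-6)*u^3 := by
  obtain ⟨k, rfl⟩ : ∃ k, m = k + 1 := ⟨m - 1, by ring⟩
  have hk : 0 ≤ k := by linarith
  set m := k + 1 with hmk
  set D := 2 * m ^ 2 + 1 with hD
  set A := 8*m^2+8*m+2 with hA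
  set B := 16*m^3+48*m^2+40*m-2 with hB
  set C := 8*m^4+48*m^3+86*m^2+48*m-10 with hC
  set P := 10*m^4+35*m^3+44*m^2+16*m-6 with hP
  have hDp : 0 < D := by positivity
  have hPp : 0 < P := by rw [hP, hmk]; ring_nf; positivity
  have hK : 0 < C * D - P := by rw [hC, hD, hP, hmk]; ring_nf; positivity
  have hdisc : 0 < 4 * A * (C * D - P) - B ^ 2 * D := by
    rw [hA, hB, hC, hD, hP, hmk]; ring_nf; positivity
  have h1 : 0 < A * D - B * D * u + (C * D - P) * u ^ 2 := by
    have : 0 < 4 * (C * D - P) * (A * D - B * D * u + (C * D - P) * u ^ 2) := by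
      have e : 4 * (C * D - P) * (A * D - B * D * u + (C * D - P) * u ^ 2)
        = (2 * (C * D - P) * u - B * D) ^ 2 + D * (4 * A * (C * D - P) - B ^ 2 * D) := by ring
      rw [e]
      have := mul_pos hDp hdisc
      positivity
    exact pos_of_mul_pos_right this (by positivity)
  have h2 : 0 ≤ P * u ^ 2 * (1 - u * D) := mul_nonneg (by positivity) (by linarith)
  have h3 : 0 < D * (A - B * u + C * u ^ 2 - P * u ^ 3) := by nlinarith
  exact pos_of_mul_pos_right h3 hDp.le

theorem f1_pos (n : ℕ) (hn : 1 ≤ n) (α : ℝ)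
    (h1 : 2 * n * (n + 2) / (2 * n ^ 2 + 1) ≤ α) (h2 : α < ((n : ℝ) + 2) / n) :
    ((n : ℝ) * (10 * n ^ 4 + 35 * n ^ 3 + 44 * n ^ 2 + 16 * n - 6) / (n + 2) ^ 2) * α ^ 3
      - ((22 * (n : ℝ) ^ 4 + 57 * n ^ 3 + 46 * n ^ 2 - 8) / (n + 2)) * α ^ 2
      + (14 * (n : ℝ) ^ 3 + 25 * n ^ 2 + 8 * n - 8) * α
      - ((n : ℝ) + 2) ^ 2 * (2 * n - 1) > 0 := by
  have hm : (1 : ℝ) ≤ n := by exact_mod_cast hn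
  generalize (n : ℝ) = m at *
  have hm0 : 0 < m := by linarith
  have hm2 : 0 < m + 2 := by linarith
  obtain ⟨u, rfl⟩ : ∃ u, α = (m + 2) / m * (1 - u) :=
    ⟨1 - α * m / (m + 2), by field_simp; ring⟩
  have hq : 0 < (m + 2) / m := by positivity
  have hu : 0 < u := by
    by_contra h
    nlinarith
  have hu2 : u * (2 * m ^ 2 + 1) ≤ 1 := by
    rw [div_le_iff₀ (by positivity)] at h1
    have e : (m + 2) / m * (1 - u) * (2 * m ^ 2 + 1) - 2 * m * (m + 2)
      = (m + 2) / m * (1 - u * (2 * m ^ 2 + 1)) := by field_simp; ring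
    have : 0 ≤ (m + 2) / m * (1 - u * (2 * m ^ 2 + 1)) := by linarith
    have := nonneg_of_mul_nonneg_right this hq
    linarith
  have key := f1_aux m u hm hu hu2
  have key2 : 0 < (m + 2) / m ^ 2 * _ := mul_pos (by positivity) key
  refine lt_of_lt_of_eq key2 ?_
  field_simp
  ring
end

section
/- Let n ≥ 1 be an integer and let α be a real number with 2n(n+2)/(2n²+1) ≤ α < (n+2)/n. Then 3n(10n⁴+35n³+44n²+16n−6)·(α/(n+2))² − 2(22n⁴+57n³+46n²−8)·(α/(n+2)) + (14n³+25n²+8n−8) > 0. (This quantity is the derivative f₁′(α) of the cubic f₁(α) = (n(10n⁴+35n³+44n²+16n−6)/(n+2)²)·α³ − ((22n⁴+57n³+46n²−8)/(n+2))·α² + (14n³+25n²+8n−8)·α − (n+2)²(2n−1), so f₁ is strictly increasing on this interval.) -/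
theorem f1_deriv_pos (n : ℕ) (hn : 1 ≤ n) (α : ℝ)
    (h1 : 2 * (n : ℝ) * (n + 2) / (2 * (n : ℝ) ^ 2 + 1) ≤ α)
    (h2 : α < ((n : ℝ) + 2) / n) :
    3 * (n : ℝ) * (10 * n ^ 4 + 35 * n ^ 3 + 44 * n ^ 2 + 16 * n - 6) * (α / (n + 2)) ^ 2
      - 2 * (22 * (n : ℝ) ^ 4 + 57 * n ^ 3 + 46 * n ^ 2 - 8) * (α / (n + 2))
      + (14 * (n : ℝ) ^ 3 + 25 * n ^ 2 + 8 * n - 8) > 0 := by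
  obtain ⟨m, rfl⟩ := Nat.exists_eq_add_of_le' hn
  push_cast at *
  have hm : (0 : ℝ) ≤ m := Nat.cast_nonneg m
  generalize (m : ℝ) = m at *
  have hD : (0 : ℝ) < 2 * (m + 1) ^ 2 + 1 := by positivity
  obtain ⟨x, hx⟩ : ∃ x, x = α / (m + 1 + 2) := ⟨_, rfl⟩
  have hα : α = x * (m + 1 + 2) := by rw [hx]; field_simp
  rw [← hx]
  rw [div_le_iff₀ hD, hα] at h1
  have hy : 0 ≤ x * (2 * (m + 1) ^ 2 + 1) - 2 * (m + 1) := by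
    by_contra h
    push Not at h
    nlinarith [mul_pos_of_neg_of_neg h (show -(m + 1 + 2) < 0 by linarith)]
  obtain ⟨y, hyx⟩ : ∃ y, y = x * (2 * (m + 1) ^ 2 + 1) - 2 * (m + 1) := ⟨_, rfl⟩
  rw [← hyx] at hy
  have hx' : x = (y + 2 * (m + 1)) / (2 * (m + 1) ^ 2 + 1) := by
    rw [hyx]; field_simp; ring
  rw [hx']
  refine pos_of_mul_pos_left (b := (2 * (m + 1) ^ 2 + 1) ^ 2) ?_ (by positivity)
  field_simp
  ring_nf
  positivity
end

section
/- Let n ≥ 1 be an integer and let α be a real number with 2n(n+2)/(2n²+1) ≤ α ≤ (n+2)/n. Then f₂(α) > 0, where f₂(α) = −(37n²+10n−2)·(α/(n+2))² + 18(3n+1)·(α/(n+2)) − 9. -/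
lemma concave_aux (A B C a b t : ℝ) (hA : 0 ≤ A) (hab : a < b) (h1 : a ≤ t) (h2 : t ≤ b)
    (ha : -A * a ^ 2 + B * a - C > 0) (hb : -A * b ^ 2 + B * b - C > 0) :
    -A * t ^ 2 + B * t - C > 0 := by
  have key : (b - a) * (-A * t ^ 2 + B * t - C) =
      (b - t) * (-A * a ^ 2 + B * a - C) + (t - a) * (-A * b ^ 2 + B * b - C)
        + A * (b - a) * ((t - a) * (b - t)) := by ring
  have h3 : 0 ≤ A * (b - a) * ((t - a) * (b - t)) :=
    mul_nonneg (mul_nonneg hA (by linarith)) (mul_nonneg (by linarith) (by linarith))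
  have h4 : 0 < (b - t) * (-A * a ^ 2 + B * a - C) + (t - a) * (-A * b ^ 2 + B * b - C) := by
    rcases h1.eq_or_lt with h | h
    · subst h
      have := mul_pos (sub_pos.2 hab) ha
      linarith
    · have := mul_pos (sub_pos.2 h) hb
      have := mul_nonneg (sub_nonneg.2 h2) ha.le
      linarith
  have h5 : 0 < (b - a) * (-A * t ^ 2 + B * t - C) := by linarith
  exact pos_of_mul_pos_right h5 (by linarith)

theorem f2_pos (n : ℕ) (hn : 1 ≤ n) (α : ℝ)
    (h1 : 2 * (n : ℝ) * (n + 2) / (2 * (n : ℝ) ^ 2 + 1) ≤ α)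
    (h2 : α ≤ ((n : ℝ) + 2) / n) :
    -(37 * (n : ℝ) ^ 2 + 10 * n - 2) * (α / (n + 2)) ^ 2
      + 18 * (3 * (n : ℝ) + 1) * (α / (n + 2)) - 9 > 0 := by
  have hx : (1 : ℝ) ≤ n := by exact_mod_cast hn
  generalize (n : ℝ) = x at *
  have hx0 : 0 < x := by linarith
  have hx2 : 0 < x + 2 := by linarith
  have hd : 0 < 2 * x ^ 2 + 1 := by positivity
  apply concave_aux _ _ _ (2 * x / (2 * x ^ 2 + 1)) (1 / x)
  · nlinarith
  · rw [div_lt_div_iff₀ hd hx0]; nlinarith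
  · rw [le_div_iff₀ hx2]; refine le_trans (le_of_eq ?_) h1; ring
  · rw [div_le_iff₀ hx2]; refine le_trans h2 (le_of_eq ?_); ring
  · have : -(37 * x ^ 2 + 10 * x - 2) * (2 * x / (2 * x ^ 2 + 1)) ^ 2
      + 18 * (3 * x + 1) * (2 * x / (2 * x ^ 2 + 1)) - 9
      = (32 * x ^ 4 + 32 * x ^ 3 + 80 * x ^ 2 + 36 * x - 9) / (2 * x ^ 2 + 1) ^ 2 := by
      field_simp; ring
    rw [this]
    apply div_pos _ (by positivity)
    have : 0 < 32 * x ^ 4 + 32 * x ^ 3 + 80 * x ^ 2 := by positivity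
    linarith
  · have : -(37 * x ^ 2 + 10 * x - 2) * (1 / x) ^ 2 + 18 * (3 * x + 1) * (1 / x) - 9
      = (8 * x ^ 2 + 8 * x + 2) / x ^ 2 := by
      field_simp; ring
    rw [this]
    positivity
end

section
/- Let n ≥ 1 be an integer and let α be a real number with 2n(n+2)/(2n²+1) ≤ α ≤ (n+2)/n. Then f₃(α) > 0, where f₃(α) = −2(2n−1)(11n²+14n+2)·(α/(n+2))² + (79n²+58n−2)·(α/(n+2)) − 27n. -/
theorem f3_pos (n : ℕ) (hn : 1 ≤ n) (α : ℝ)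
    (h1 : 2 * (n : ℝ) * (n + 2) / (2 * (n : ℝ) ^ 2 + 1) ≤ α)
    (h2 : α ≤ ((n : ℝ) + 2) / n) :
    -2 * (2 * (n : ℝ) - 1) * (11 * (n : ℝ) ^ 2 + 14 * n + 2) * (α / (n + 2)) ^ 2
      + (79 * (n : ℝ) ^ 2 + 58 * n - 2) * (α / (n + 2)) - 27 * n > 0 := by
  have hm : (1 : ℝ) ≤ n := by exact_mod_cast hn
  generalize (n : ℝ) = m at *
  have hm0 : 0 < m := by linarith
  have hp : 0 < m + 2 := by linarith
  obtain ⟨x, hx⟩ : ∃ x, x = α / (m + 2) := ⟨_, rfl⟩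
  have hα : α = x * (m + 2) := by rw [hx]; field_simp
  rw [← hx]
  rw [div_le_iff₀ (by positivity), hα] at h1
  rw [le_div_iff₀ hm0, hα] at h2
  obtain ⟨u, hu⟩ : ∃ u, u = 1 - m * x := ⟨_, rfl⟩
  obtain ⟨v, hv⟩ : ∃ v, v = x * (2 * m ^ 2 + 1) - 2 * m := ⟨_, rfl⟩
  have hu0 : 0 ≤ u := by
    have : 0 ≤ u * (m + 2) := by rw [hu]; linarith
    exact nonneg_of_mul_nonneg_left this hp
  have hv0 : 0 ≤ v := by
    have : 0 ≤ v * (m + 2) := by rw [hv]; linarith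
    exact nonneg_of_mul_nonneg_left this hp
  have hone : (2 * m ^ 2 + 1) * u + m * v = 1 := by rw [hu, hv]; ring
  obtain ⟨t, rfl⟩ : ∃ t, m = 1 + t := ⟨m - 1, by ring⟩
  have ht : 0 ≤ t := by linarith
  generalize hM : 1 + t = m at *
  have key : -2 * (2 * m - 1) * (11 * m ^ 2 + 14 * m + 2) * x ^ 2
      + (79 * m ^ 2 + 58 * m - 2) * x - 27 * m
      = (32*m^5+96*m^4+122*m^3+132*m^2-31*m) * u^2
        + (32*m^4+96*m^3+97*m^2+74*m-2) * (u*v)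
        + (8*m^3+24*m^2+18*m+4) * v^2 := by
    rw [hu, hv]; ring
  rw [key]
  have ha : 0 < 32*m^5+96*m^4+122*m^3+132*m^2-31*m := by
    rw [← hM]; ring_nf; positivity
  have hb : 0 < 32*m^4+96*m^3+97*m^2+74*m-2 := by
    rw [← hM]; ring_nf; positivity
  have hc : 0 < 8*m^3+24*m^2+18*m+4 := by positivity
  rcases hu0.eq_or_lt with h | h
  · have : v ≠ 0 := by
      rintro h'; rw [← h, h'] at hone; norm_num at hone
    positivity
  · positivity
end

section
/- Let n ≥ 1 be an integer and let α be real with 2n(n+2)/(2n²+1) ≤ α < (n+2)/n. Set τ = 1 − nα/(n+2), d₁ = n²α(3n+6−(n−1)α)/((2n+1)(n+2)²), d₄ = (n/(2n+1))·(3 − (7n+2)α/(n+2)), e₄ = n(3+α)/(2n+1), Δ₁ = 2n²α((4n+5)α−3n−6)·τ/((2n+1)(n+2)²), Θ₁ = −6n²α(α+n+2)·τ/((2n+1)(n+2)²), Ξ₁ = 6nα·τ/(2n+1). Then the real symmetric 4×4 matrix M = [[d₁, 0, −d₄/2, Δ₁/2], [0, d₁, −e₄/2, Θ₁/2], [−d₄/2,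 −e₄/2, 3, Ξ₁/2], [Δ₁/2, Θ₁/2, Ξ₁/2, 2d₁ α τ]] is positive definite. -/
open Matrix in
/-- Positive definiteness of a bordered 4×4 matrix through two successive Schur complements. -/
theorem posdef_aux (a p q r v w x y : ℝ) (ha : 0 < a) (hA : 0 < a * r - p ^ 2 - q ^ 2)
    (hD : (a * x - p * v - q * w) ^ 2 < (a * r - p ^ 2 - q ^ 2) * (a * y - v ^ 2 - w ^ 2)) :
    (!![a, 0, p, v; 0, a, q, w; p, q, r, x; v, w, x, y] : Matrix (Fin 4) (Fin 4) ℝ).PosDef := by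
  refine Matrix.PosDef.of_dotProduct_mulVec_pos ?_ ?_
  · ext i j
    fin_cases i <;> fin_cases j <;> simp
  · intro z hz
    have hex : star z ⬝ᵥ (!![a, 0, p, v; 0, a, q, w; p, q, r, x; v, w, x, y] *ᵥ z) =
        a * z 0 ^ 2 + a * z 1 ^ 2 + r * z 2 ^ 2 + y * z 3 ^ 2 + 2 * p * z 0 * z 2
        + 2 * v * z 0 * z 3 + 2 * q * z 1 * z 2 + 2 * w * z 1 * z 3 + 2 * x * z 2 * z 3 := by
      simp [Matrix.mulVec, dotProduct, Fin.sum_univ_four]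
      ring
    rw [hex]
    generalize hQ : a * z 0 ^ 2 + a * z 1 ^ 2 + r * z 2 ^ 2 + y * z 3 ^ 2 + 2 * p * z 0 * z 2
        + 2 * v * z 0 * z 3 + 2 * q * z 1 * z 2 + 2 * w * z 1 * z 3 + 2 * x * z 2 * z 3 = Q
    set A := a * r - p ^ 2 - q ^ 2 with hAd
    set B := a * x - p * v - q * w with hBd
    set C := a * y - v ^ 2 - w ^ 2 with hCd
    have key : A * a * Q = A * (a * z 0 + p * z 2 + v * z 3) ^ 2
        + A * (a * z 1 + q * z 2 + w * z 3) ^ 2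
        + (A * z 2 + B * z 3) ^ 2 + (A * C - B ^ 2) * z 3 ^ 2 := by
      rw [← hQ, hAd, hBd, hCd]; ring
    have hDp : 0 < A * C - B ^ 2 := by linarith
    have hpos : 0 < A * a * Q := by
      have t1 : 0 ≤ A * (a * z 0 + p * z 2 + v * z 3) ^ 2 := by positivity
      have t2 : 0 ≤ A * (a * z 1 + q * z 2 + w * z 3) ^ 2 := by positivity
      have t3 : 0 ≤ (A * z 2 + B * z 3) ^ 2 := by positivity
      have t4 : 0 ≤ (A * C - B ^ 2) * z 3 ^ 2 := by positivity
      by_contra hn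
      have e1 : A * (a * z 0 + p * z 2 + v * z 3) ^ 2 = 0 := by linarith
      have e2 : A * (a * z 1 + q * z 2 + w * z 3) ^ 2 = 0 := by linarith
      have e3 : (A * z 2 + B * z 3) ^ 2 = 0 := by linarith
      have e4 : (A * C - B ^ 2) * z 3 ^ 2 = 0 := by linarith
      have z3 : z 3 = 0 := by simpa [hDp.ne'] using e4
      have z2 : z 2 = 0 := by simpa [z3, hA.ne'] using e3
      have z1 : z 1 = 0 := by simpa [z3, z2, hA.ne', ha.ne'] using e2
      have z0 : z 0 = 0 := by simpa [z3, z2, hA.ne', ha.ne'] using e1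
      apply hz
      ext i
      fin_cases i <;> simp [z0, z1, z2, z3]
    exact pos_of_mul_pos_right hpos (by positivity)

/-- Cleared numerators of the Schur complements; `n = 1 + m`, `1/τ = 2n²+1+u`. -/
theorem numer_pos (n K : ℝ) (hn : 1 ≤ n) (hK : 2 * n ^ 2 + 1 ≤ K) :
    0 < 12 * (2 * n + 1) * (K - 1) * ((2 * n + 1) * K + (n - 1))
        - ((3 * n * K - (7 * n + 2) * (K - 1)) ^ 2 + (3 * n * K + (n + 2) * (K - 1)) ^ 2) ∧
    0 < (12 * (2 * n + 1) * (K - 1) * ((2 * n + 1) * K + (n - 1))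
        - ((3 * n * K - (7 * n + 2) * (K - 1)) ^ 2 + (3 * n * K + (n + 2) * (K - 1)) ^ 2)) *
      (2 * (n + 2) * ((2 * n + 1) * K + (n - 1)) ^ 2 * (K - 1)
        - n * (((4 * n + 5) * (K - 1) - 3 * n * K) ^ 2 + 9 * ((K - 1) + n * K) ^ 2))
      - n * (6 * (n + 2) * (K - 1) * ((2 * n + 1) * K + (n - 1))
        + (3 * n * K - (7 * n + 2) * (K - 1)) * ((4 * n + 5) * (K - 1) - 3 * n * K)
        - 3 * (3 * n * K + (n + 2) * (K - 1)) * ((K - 1) + n * K)) ^ 2 := by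
  obtain ⟨m, hm, rfl⟩ : ∃ m : ℝ, 0 ≤ m ∧ n = 1 + m := ⟨n - 1, by linarith, by ring⟩
  obtain ⟨u, hu, rfl⟩ : ∃ u : ℝ, 0 ≤ u ∧ K = 2 * (1 + m) ^ 2 + 1 + u :=
    ⟨K - (2 * (1 + m) ^ 2 + 1), by linarith, by ring⟩
  constructor
  · ring_nf
    positivity
  · ring_nf
    positivity

theorem matrix_Q1_posdef (n : ℕ) (hn : 1 ≤ n) (α : ℝ)
    (h1 : 2 * (n : ℝ) * (n + 2) / (2 * (n : ℝ) ^ 2 + 1) ≤ α)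
    (h2 : α < ((n : ℝ) + 2) / n) :
    (!![(n : ℝ) ^ 2 * α * (3 * n + 6 - (n - 1) * α) / ((2 * n + 1) * (n + 2) ^ 2), 0,
          -((n : ℝ) / (2 * n + 1) * (3 - (7 * n + 2) * α / (n + 2))) / 2,
          (2 * (n : ℝ) ^ 2 * α * ((4 * n + 5) * α - 3 * n - 6) * (1 - n * α / (n + 2)) /
            ((2 * n + 1) * (n + 2) ^ 2)) / 2;
        0, (n : ℝ) ^ 2 * α * (3 * n + 6 - (n - 1) * α) / ((2 * n + 1) * (n + 2) ^ 2),
          -((n : ℝ) * (3 + α) / (2 * n + 1)) / 2,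
          (-6 * (n : ℝ) ^ 2 * α * (α + n + 2) * (1 - n * α / (n + 2)) /
            ((2 * n + 1) * (n + 2) ^ 2)) / 2;
        -((n : ℝ) / (2 * n + 1) * (3 - (7 * n + 2) * α / (n + 2))) / 2,
          -((n : ℝ) * (3 + α) / (2 * n + 1)) / 2, 3,
          (6 * (n : ℝ) * α * (1 - n * α / (n + 2)) / (2 * n + 1)) / 2;
        (2 * (n : ℝ) ^ 2 * α * ((4 * n + 5) * α - 3 * n - 6) * (1 - n * α / (n + 2)) /
            ((2 * n + 1) * (n + 2) ^ 2)) / 2,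
          (-6 * (n : ℝ) ^ 2 * α * (α + n + 2) * (1 - n * α / (n + 2)) /
            ((2 * n + 1) * (n + 2) ^ 2)) / 2,
          (6 * (n : ℝ) * α * (1 - n * α / (n + 2)) / (2 * n + 1)) / 2,
          2 * ((n : ℝ) ^ 2 * α * (3 * n + 6 - (n - 1) * α) / ((2 * n + 1) * (n + 2) ^ 2)) *
            α * (1 - n * α / (n + 2))] : Matrix (Fin 4) (Fin 4) ℝ).PosDef := by
  have hn' : (1 : ℝ) ≤ n := by exact_mod_cast hn
  generalize (n : ℝ) = n at *
  have hn0 : 0 < n := by linarith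
  obtain ⟨K, hK, rfl⟩ : ∃ K : ℝ, 2 * n ^ 2 + 1 ≤ K ∧ α = (n + 2) * (K - 1) / (n * K) := by
    rw [div_le_iff₀ (by positivity)] at h1
    rw [lt_div_iff₀ hn0] at h2
    have hp : 0 < n + 2 - n * α := by linarith
    refine ⟨(n + 2) / (n + 2 - n * α), ?_, ?_⟩
    · rw [le_div_iff₀ hp]
      nlinarith
    · field_simp
      ring
  clear h1 h2
  have hK1 : 0 < K - 1 := by nlinarith
  have hK0 : 0 < K := by linarith
  obtain ⟨hA, hT⟩ := numer_pos n K hn' hK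
  have hG : 0 < (2 * n + 1) * K + (n - 1) := by nlinarith
  have ea : n ^ 2 * ((n + 2) * (K - 1) / (n * K)) *
      (3 * n + 6 - (n - 1) * ((n + 2) * (K - 1) / (n * K))) / ((2 * n + 1) * (n + 2) ^ 2) =
      (K - 1) * ((2 * n + 1) * K + (n - 1)) / ((2 * n + 1) * K ^ 2) := by
    field_simp
    ring
  have et : 1 - n * ((n + 2) * (K - 1) / (n * K)) / (n + 2) = 1 / K := by
    field_simp
    ring
  rw [ea, et]
  apply posdef_aux
  · positivity
  · refine lt_of_lt_of_eq (div_pos hA (by positivity : 0 < 4 * (2 * n + 1) ^ 2 * K ^ 2)) ?_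
    field_simp
    ring
  · rw [← sub_pos]
    refine lt_of_lt_of_eq (mul_pos hT
      (by positivity : 0 < (K - 1) ^ 2 / (4 * n * (2 * n + 1) ^ 4 * K ^ 8))) ?_
    field_simp
    ring
end

section
/- Let n ≥ 1 be an integer and let α be any real number. Set τ = 1 − nα/(n+2), d₁ = n²α(3n+6−(n−1)α)/((2n+1)(n+2)²), d₄ = (n/(2n+1))·(3 − (7n+2)α/(n+2)), e₄ = n(3+α)/(2n+1), Δ₁ = 2n²α((4n+5)α−3n−6)·τ/((2n+1)(n+2)²), Θ₁ = −6n²α(α+n+2)·τ/((2n+1)(n+2)²), Ξ₁ = 6nα·τ/(2n+1), and M = [[d₁, 0, −d₄/2, Δ₁/2], [0, d₁, −e₄/2, Θ₁/2], [−d₄/2, −e₄/2, 3, Ξ₁/2], [Δ₁/2, Θ₁/2, Ξ₁/2, 2d₁ α τ]]. Then det M = (n⁶ α³ (3 − (n−1)α/(n+2))² / ((n+2)³ (2n+1)⁴)) · τ · f₃(α), where f₃(α) = −2(2n−1)(11n²+14n+2)·(α/(n+2))² + (79n²+58n−2)·(α/(n+2)) − 27n. -/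
theorem det_symm_aux (d p q r s x w : ℝ) :
    (!![d, 0, p, r; 0, d, q, s; p, q, 3, x; r, s, x, w] : Matrix (Fin 4) (Fin 4) ℝ).det =
      d * (3 * d * w - d * x ^ 2 - w * p ^ 2 - w * q ^ 2 - 3 * r ^ 2 - 3 * s ^ 2
        + 2 * p * r * x + 2 * q * s * x) + (p * s - q * r) ^ 2 := by
  simp [Matrix.det_succ_row_zero, Fin.sum_univ_succ, Fin.succAbove]
  ring

theorem matrix_Q1_det (n : ℕ) (hn : 1 ≤ n) (α : ℝ) :
    (!![(n : ℝ) ^ 2 * α * (3 * n + 6 - (n - 1) * α) / ((2 * n + 1) * (n + 2) ^ 2), 0,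
          -((n : ℝ) / (2 * n + 1) * (3 - (7 * n + 2) * α / (n + 2))) / 2,
          (2 * (n : ℝ) ^ 2 * α * ((4 * n + 5) * α - 3 * n - 6) * (1 - n * α / (n + 2)) /
            ((2 * n + 1) * (n + 2) ^ 2)) / 2;
        0, (n : ℝ) ^ 2 * α * (3 * n + 6 - (n - 1) * α) / ((2 * n + 1) * (n + 2) ^ 2),
          -((n : ℝ) * (3 + α) / (2 * n + 1)) / 2,
          (-6 * (n : ℝ) ^ 2 * α * (α + n + 2) * (1 - n * α / (n + 2)) /
            ((2 * n + 1) * (n + 2) ^ 2)) / 2;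
        -((n : ℝ) / (2 * n + 1) * (3 - (7 * n + 2) * α / (n + 2))) / 2,
          -((n : ℝ) * (3 + α) / (2 * n + 1)) / 2, 3,
          (6 * (n : ℝ) * α * (1 - n * α / (n + 2)) / (2 * n + 1)) / 2;
        (2 * (n : ℝ) ^ 2 * α * ((4 * n + 5) * α - 3 * n - 6) * (1 - n * α / (n + 2)) /
            ((2 * n + 1) * (n + 2) ^ 2)) / 2,
          (-6 * (n : ℝ) ^ 2 * α * (α + n + 2) * (1 - n * α / (n + 2)) /
            ((2 * n + 1) * (n + 2) ^ 2)) / 2,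
          (6 * (n : ℝ) * α * (1 - n * α / (n + 2)) / (2 * n + 1)) / 2,
          2 * ((n : ℝ) ^ 2 * α * (3 * n + 6 - (n - 1) * α) / ((2 * n + 1) * (n + 2) ^ 2)) *
            α * (1 - n * α / (n + 2))] : Matrix (Fin 4) (Fin 4) ℝ).det =
      ((n : ℝ) ^ 6 * α ^ 3 * (3 - (n - 1) * α / (n + 2)) ^ 2 /
          ((n + 2) ^ 3 * (2 * n + 1) ^ 4)) * (1 - n * α / (n + 2)) *
        (-2 * (2 * (n : ℝ) - 1) * (11 * (n : ℝ) ^ 2 + 14 * n + 2) * (α / (n + 2)) ^ 2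
          + (79 * (n : ℝ) ^ 2 + 58 * n - 2) * (α / (n + 2)) - 27 * n) := by
  have h2 : (n : ℝ) + 2 ≠ 0 := by positivity
  have h1 : 2 * (n : ℝ) + 1 ≠ 0 := by positivity
  rw [det_symm_aux]
  generalize (n : ℝ) = m at h1 h2 ⊢
  obtain ⟨b, rfl⟩ : ∃ b, α = b * (m + 2) := ⟨α / (m + 2), by field_simp⟩
  have e1 : m ^ 2 * (b * (m + 2)) * (3 * m + 6 - (m - 1) * (b * (m + 2))) /
      ((2 * m + 1) * (m + 2) ^ 2) = m ^ 2 * b * (3 - (m - 1) * b) / (2 * m + 1) := by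
    field_simp
    ring
  have e2 : (7 * m + 2) * (b * (m + 2)) / (m + 2) = (7 * m + 2) * b := by field_simp
  have e3 : m * (b * (m + 2)) / (m + 2) = m * b := by field_simp
  have e4 : (m - 1) * (b * (m + 2)) / (m + 2) = (m - 1) * b := by field_simp
  have e5 : b * (m + 2) / (m + 2) = b := by field_simp
  rw [e1, e2, e3, e4, e5]
  have e6 : 2 * m ^ 2 * (b * (m + 2)) * ((4 * m + 5) * (b * (m + 2)) - 3 * m - 6) *
      (1 - m * b) / ((2 * m + 1) * (m + 2) ^ 2) =
      2 * m ^ 2 * b * ((4 * m + 5) * b - 3) * (1 - m * b) / (2 * m + 1) := by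
    field_simp
    ring
  have e7 : -6 * m ^ 2 * (b * (m + 2)) * (b * (m + 2) + m + 2) *
      (1 - m * b) / ((2 * m + 1) * (m + 2) ^ 2) =
      -6 * m ^ 2 * b * (b + 1) * (1 - m * b) / (2 * m + 1) := by
    field_simp
    ring
  have e8 : m ^ 6 * (b * (m + 2)) ^ 3 * (3 - (m - 1) * b) ^ 2 /
      ((m + 2) ^ 3 * (2 * m + 1) ^ 4) =
      m ^ 6 * b ^ 3 * (3 - (m - 1) * b) ^ 2 / (2 * m + 1) ^ 4 := by
    field_simp
  rw [e6, e7, e8]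
  field_simp
  ring
end

section
/- For every real number α with 53/50 ≤ α < 3, the real symmetric 3×3 matrix M(α) = [[α(5α−3)/18, (2α/3)−1, α(3−α)(5α−3)/216], [(2α/3)−1, 3, α(3−α)/12], [α(3−α)(5α−3)/216, α(3−α)/12, α(3−α)(α−1)(α+3)/18]] is positive definite. -/
theorem matrix_Q2_posdef (α : ℝ) (h1 : 53 / 50 ≤ α) (h2 : α < 3) :
    (!![α * (5 * α - 3) / 18, 2 * α / 3 - 1, α * (3 - α) * (5 * α - 3) / 216;
        2 * α / 3 - 1, 3, α * (3 - α) / 12;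
        α * (3 - α) * (5 * α - 3) / 216, α * (3 - α) / 12,
          α * (3 - α) * (α - 1) * (α + 3) / 18] : Matrix (Fin 3) (Fin 3) ℝ).PosDef := by
  have hA : 0 < (7 * α ^ 2 + 15 * α - 18) / 54 := by nlinarith
  have hP : 0 < 2 * (7 * α ^ 2 + 15 * α - 18) * (25 * α ^ 2 + 45 * α - 72)
      - α * (3 - α) * (α + 3) ^ 2 := by
    obtain ⟨t, rfl⟩ : ∃ t, α = 53 / 50 + t := ⟨α - 53 / 50, by ring⟩
    have ht : 0 ≤ t := by linarith
    ring_nf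
    positivity
  have hD : 0 < α * (3 - α) / 46656 * (2 * (7 * α ^ 2 + 15 * α - 18) * (25 * α ^ 2 + 45 * α - 72)
      - α * (3 - α) * (α + 3) ^ 2) := by
    have : 0 < α * (3 - α) := mul_pos (by linarith) (by linarith)
    positivity
  apply Matrix.PosDef.of_dotProduct_mulVec_pos
  · ext i j
    fin_cases i <;> fin_cases j <;> simp [Matrix.conjTranspose_apply]
  · intro v hv
    obtain ⟨x, hx⟩ : ∃ x, x = v 0 := ⟨_, rfl⟩
    obtain ⟨y, hy⟩ : ∃ y, y = v 1 := ⟨_, rfl⟩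
    obtain ⟨z, hz⟩ : ∃ z, z = v 2 := ⟨_, rfl⟩
    simp only [dotProduct, Matrix.mulVec, Fin.sum_univ_three, Pi.star_apply, star_trivial]
    simp only [← hx, ← hy, ← hz]
    simp only [Matrix.of_apply, Matrix.cons_val]
    set A := (7 * α ^ 2 + 15 * α - 18) / 54 with hAd
    set D := α * (3 - α) / 46656 * (2 * (7 * α ^ 2 + 15 * α - 18) * (25 * α ^ 2 + 45 * α - 72)
      - α * (3 - α) * (α + 3) ^ 2) with hDd
    have key : 0 < 3 * A * (y + ((2 * α / 3 - 1) * x + α * (3 - α) / 12 * z) / 3) ^ 2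
        + (A * x + α * (3 - α) * (α + 3) / 216 * z) ^ 2 + D * z ^ 2 := by
      by_cases z0 : z = 0
      · by_cases x0 : x = 0
        · have y0 : y ≠ 0 := by
            intro y0
            apply hv
            ext i
            fin_cases i
            · exact hx ▸ x0
            · exact hy ▸ y0
            · exact hz ▸ z0
          rw [z0, x0]
          have : 0 < 3 * A * y ^ 2 := by positivity
          nlinarith
        · rw [z0]
          have : 0 < (A * x) ^ 2 := by positivity
          have : 0 ≤ 3 * A * (y + ((2 * α / 3 - 1) * x + α * (3 - α) / 12 * 0) / 3) ^ 2 := by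
            positivity
          simp only [mul_zero, add_zero] at *
          nlinarith
      · have : 0 < D * z ^ 2 := by positivity
        have : 0 ≤ 3 * A * (y + ((2 * α / 3 - 1) * x + α * (3 - α) / 12 * z) / 3) ^ 2 := by
          positivity
        nlinarith [sq_nonneg (A * x + α * (3 - α) * (α + 3) / 216 * z)]
    refine pos_of_mul_pos_right (a := A) (lt_of_lt_of_eq key ?_) hA.le
    rw [hDd, hAd]
    ring
end

section
/- For every real number α with 1 < α ≤ 53/50, set Δ₁′ = (30α³ − 95α² + 132α − 63)/270, Δ₄′ = (360α² − 365α + 116)/360, Ξ₁′ = −(40α² + 15α − 92)/120, Ξ₄′ = α − 5/2, and A = (80α⁴ − 600α³ + 1468α² − 1272α + 405)/2160. Then the real symmetric 4×4 matrix M(α) = [[1/9, −1/3, Δ₄′/2, Δ₁′/2], [−1/3, 3, Ξ₄′/2, Ξ₁′/2], [Δ₄′/2, Ξ₄′/2, 9/20, 0], [Δ₁′/2, Ξ₁′/2, 0, A]] is positive definite. -/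
set_option maxHeartbeats 4000000 in
/-- Positivity of a quadratic form of the shape of the theorem, from bounds on its entries. -/
lemma quad_pos (p q r s A : ℝ) (hp1 : 3 / 20 ≤ p) (hp2 : p ≤ 1856 / 10000)
    (hq1 : 7 / 1000 ≤ q) (hq2 : q ≤ 11 / 1000)
    (hu1 : -(2876 / 10000) ≤ r + 3 * p) (hu2 : r + 3 * p ≤ -(16 / 100))
    (hv1 : 15 / 100 ≤ s + 3 * q) (hv2 : s + 3 * q ≤ 19 / 100) (hA : 374 / 10000 ≤ A)
    (a b c d : ℝ) (hne : ¬ (a = 0 ∧ b = 0 ∧ c = 0 ∧ d = 0)) :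
    0 < 1 / 9 * a ^ 2 + 3 * b ^ 2 + 9 / 20 * c ^ 2 + A * d ^ 2
      + 2 * (-(1 / 3) * a * b + p * a * c + q * a * d + r * b * c + s * b * d) := by
  obtain ⟨u, hu⟩ : ∃ u, u = r + 3 * p := ⟨_, rfl⟩
  obtain ⟨v, hv⟩ : ∃ v, v = s + 3 * q := ⟨_, rfl⟩
  rw [← hu] at hu1 hu2
  rw [← hv] at hv1 hv2
  have hpp : p ^ 2 ≤ 345 / 10000 := by nlinarith
  have hqq : q ^ 2 ≤ 121 / 1000000 := by nlinarith
  have huu : u ^ 2 ≤ 83 / 1000 := by nlinarith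
  have hvv : v ^ 2 ≤ 361 / 10000 := by nlinarith
  have hpq1 : 0 ≤ p * q := by nlinarith
  have hpq2 : p * q ≤ 205 / 100000 := by nlinarith
  have huv1 : -(55 / 1000) ≤ u * v := by nlinarith
  have huv2 : u * v ≤ -(24 / 1000) := by nlinarith
  obtain ⟨X, hX⟩ : ∃ X, X = 9 / 20 - 9 * p ^ 2 - u ^ 2 / 2 := ⟨_, rfl⟩
  obtain ⟨Y, hY⟩ : ∃ Y, Y = -9 * (p * q) - u * v / 2 := ⟨_, rfl⟩
  obtain ⟨Z, hZ⟩ : ∃ Z, Z = A - 9 * q ^ 2 - v ^ 2 / 2 := ⟨_, rfl⟩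
  have hX1 : 9 / 100 ≤ X := by linarith
  have hZ1 : 17 / 1000 ≤ Z := by linarith
  have hY1 : -(28 / 1000) ≤ Y := by linarith
  have hY2 : Y ≤ 28 / 1000 := by linarith
  have hYY : Y ^ 2 ≤ 784 / 1000000 := by nlinarith
  have key : 1 / 9 * a ^ 2 + 3 * b ^ 2 + 9 / 20 * c ^ 2 + A * d ^ 2
      + 2 * (-(1 / 3) * a * b + p * a * c + q * a * d + r * b * c + s * b * d)
      = 1 / 9 * (a - 3 * b + 9 * p * c + 9 * q * d) ^ 2 + 2 * (b + (u * c + v * d) / 2) ^ 2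
        + (X * c ^ 2 + 2 * Y * c * d + Z * d ^ 2) := by
    rw [hX, hY, hZ, hu, hv]; ring
  -- the remaining binary form is bounded below by a positive diagonal form
  have hbin : 1 / 100 * c ^ 2 + 1 / 1000 * d ^ 2 ≤ X * c ^ 2 + 2 * Y * c * d + Z * d ^ 2 := by
    have e1 : 0 ≤ (X - 9 / 100) * c ^ 2 := mul_nonneg (by linarith) (sq_nonneg c)
    have e2 : 0 ≤ (Z - 17 / 1000) * d ^ 2 := mul_nonneg (by linarith) (sq_nonneg d)
    have e3 : 0 ≤ (784 / 1000000 - Y ^ 2) * d ^ 2 := mul_nonneg (by linarith) (sq_nonneg d)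
    have e4 : 0 ≤ (8 / 100 * c + Y * d) ^ 2 := sq_nonneg _
    nlinarith [sq_nonneg d]
  rw [key]
  by_contra hle
  have s1 := sq_nonneg (a - 3 * b + 9 * p * c + 9 * q * d)
  have s2 := sq_nonneg (b + (u * c + v * d) / 2)
  have hc : c = 0 := pow_eq_zero_iff (two_ne_zero) |>.1
    (le_antisymm (by nlinarith [sq_nonneg c, sq_nonneg d]) (sq_nonneg c))
  have hd : d = 0 := pow_eq_zero_iff (two_ne_zero) |>.1
    (le_antisymm (by nlinarith [sq_nonneg c, sq_nonneg d]) (sq_nonneg d))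
  subst hc hd
  have hb : b = 0 := pow_eq_zero_iff (two_ne_zero) |>.1
    (le_antisymm (by nlinarith) (sq_nonneg b))
  subst hb
  have ha : a = 0 := pow_eq_zero_iff (two_ne_zero) |>.1
    (le_antisymm (by nlinarith) (sq_nonneg a))
  exact hne ⟨ha, rfl, rfl, rfl⟩

theorem matrix_Q3_posdef (α : ℝ) (h1 : 1 < α) (h2 : α ≤ 53 / 50) :
    (!![1 / 9, -(1 / 3), ((360 * α ^ 2 - 365 * α + 116) / 360) / 2,
          ((30 * α ^ 3 - 95 * α ^ 2 + 132 * α - 63) / 270) / 2;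
        -(1 / 3), 3, (α - 5 / 2) / 2, (-((40 * α ^ 2 + 15 * α - 92) / 120)) / 2;
        ((360 * α ^ 2 - 365 * α + 116) / 360) / 2, (α - 5 / 2) / 2, 9 / 20, 0;
        ((30 * α ^ 3 - 95 * α ^ 2 + 132 * α - 63) / 270) / 2,
          (-((40 * α ^ 2 + 15 * α - 92) / 120)) / 2, 0,
          (80 * α ^ 4 - 600 * α ^ 3 + 1468 * α ^ 2 - 1272 * α + 405) / 2160] :
        Matrix (Fin 4) (Fin 4) ℝ).PosDef := by
  rw [Matrix.posDef_iff_dotProduct_mulVec]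
  refine ⟨?_, ?_⟩
  · ext i j
    fin_cases i <;> fin_cases j <;> simp [Matrix.conjTranspose_apply]
  · intro x hx
    obtain ⟨t, rfl⟩ : ∃ t, α = 1 + t := ⟨α - 1, by ring⟩
    have t0 : 0 ≤ t := by linarith
    have t1 : t ≤ 3 / 50 := by linarith
    have t2 : t ^ 2 ≤ 3 / 50 * t := by nlinarith
    have t2' : 0 ≤ t ^ 2 := sq_nonneg t
    have t3 : t ^ 3 ≤ 3 / 50 * t ^ 2 := by nlinarith
    have t3' : 0 ≤ t ^ 3 := by positivity
    have t4' : 0 ≤ t ^ 4 := by positivity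
    have h := quad_pos (((360 * (1 + t) ^ 2 - 365 * (1 + t) + 116) / 360) / 2)
      (((30 * (1 + t) ^ 3 - 95 * (1 + t) ^ 2 + 132 * (1 + t) - 63) / 270) / 2)
      (((1 + t) - 5 / 2) / 2) ((-((40 * (1 + t) ^ 2 + 15 * (1 + t) - 92) / 120)) / 2)
      ((80 * (1 + t) ^ 4 - 600 * (1 + t) ^ 3 + 1468 * (1 + t) ^ 2 - 1272 * (1 + t) + 405) / 2160)
      (by linarith) (by linarith) (by linarith) (by linarith) (by linarith) (by linarith)
      (by linarith) (by linarith) (by linarith) (x 0) (x 1) (x 2) (x 3)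
      (by
        rintro ⟨ha, hb, hc, hd⟩
        apply hx
        ext i
        fin_cases i <;> simp [ha, hb, hc, hd])
    refine lt_of_lt_of_eq h ?_
    simp [dotProduct, Matrix.mulVec, Fin.sum_univ_four]
    ring
end

section
/- Let n ≥ 2 be an integer and let β, μ, a, b, d₁, d₂, d₄, e₁, e₂, e₄ be real numbers satisfying the eight equations: (β+(n+3)/n)d₁ − ((n−1)/n)e₁ + (1/n)d₄ + (β+(n+3)/n)a + 2b = 0; −(1/n)d₁ + (β+(n+4)/n)d₂ − ((n−1)/n)e₂ + (1/n)d₄ − a + b = 0; (1/n)d₁ + (β+(n+3)/n)d₄ + ((n−1)/n)e₄ + (1/n)μ + a + (nβ+n+2)b = 0; −((n+2)/n)d₁ + (β+(n+2)/n)e₁ + (1/n)e₄ − (β+(n+6)/n)a + 2b = 0; −(1/n)e₁ − ((n+2)/n)d₂ + (β+(n+3)/n)e₂ + (1/n)e₄ + ((n+1)/n)a + b = 0; ((n+2)/n)d₁ − ((n−1)/n)e₁ − (1/n)μ + (3/n)a + (nβ+n+2)b = 0; ((n+2)/n)d₂ − ((n−1)/n)e₂ − (1/n)μ − (n+1)b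 = 0; ((n+2)/n)d₄ + ((n−1)/n)e₄ − βμ + 2(n+1)b = 0. Assume moreover the sign conditions d₁d₂ ≥ 0, d₂e₂ ≥ 0, d₂μ ≥ 0 and e₂μ ≥ 0. Then either all of μ, a, b, d₁, d₂, d₄, e₁, e₂, e₄ are zero, or β = −2/n, b = (n−1)a/n², d₂ = d₁ + a, d₄ = d₁ − ((n−2)/n)a − μ, e₁ = ((n+2)(d₁+a) − μ)/(n−1), e₂ = ((n+2)d₁ + (2 + 1/n)a − μ)/(n−1), and e₄ = (−(n+2)d₁ − (n + 2/n)a + nμ)/(n−1). -/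
theorem jerison_lee_classification (n : ℕ) (hn : 2 ≤ n)
    (β μ a b d₁ d₂ d₄ e₁ e₂ e₄ : ℝ)
    (hΔ₁ : (β + ((n : ℝ) + 3) / n) * d₁ - (((n : ℝ) - 1) / n) * e₁ + (1 / (n : ℝ)) * d₄
      + (β + ((n : ℝ) + 3) / n) * a + 2 * b = 0)
    (hΔ₂ : -(1 / (n : ℝ)) * d₁ + (β + ((n : ℝ) + 4) / n) * d₂ - (((n : ℝ) - 1) / n) * e₂
      + (1 / (n : ℝ)) * d₄ - a + b = 0)
    (hΔ₄ : (1 / (n : ℝ)) * d₁ + (β + ((n : ℝ) + 3) / n) * d₄ + (((n : ℝ) - 1) / n) * e₄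
      + (1 / (n : ℝ)) * μ + a + ((n : ℝ) * β + n + 2) * b = 0)
    (hΘ₁ : -(((n : ℝ) + 2) / n) * d₁ + (β + ((n : ℝ) + 2) / n) * e₁ + (1 / (n : ℝ)) * e₄
      - (β + ((n : ℝ) + 6) / n) * a + 2 * b = 0)
    (hΘ₂ : -(1 / (n : ℝ)) * e₁ - (((n : ℝ) + 2) / n) * d₂ + (β + ((n : ℝ) + 3) / n) * e₂
      + (1 / (n : ℝ)) * e₄ + (((n : ℝ) + 1) / n) * a + b = 0)
    (hΞ₁ : (((n : ℝ) + 2) / n) * d₁ - (((n : ℝ) - 1) / n) * e₁ - (1 / (n : ℝ)) * μ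
      + (3 / (n : ℝ)) * a + ((n : ℝ) * β + n + 2) * b = 0)
    (hΞ₂ : (((n : ℝ) + 2) / n) * d₂ - (((n : ℝ) - 1) / n) * e₂ - (1 / (n : ℝ)) * μ
      - ((n : ℝ) + 1) * b = 0)
    (hΞ₄ : (((n : ℝ) + 2) / n) * d₄ + (((n : ℝ) - 1) / n) * e₄ - β * μ
      + 2 * ((n : ℝ) + 1) * b = 0)
    (hs₁ : d₁ * d₂ ≥ 0) (hs₂ : d₂ * e₂ ≥ 0) (hs₃ : d₂ * μ ≥ 0) (hs₄ : e₂ * μ ≥ 0) :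
    (μ = 0 ∧ a = 0 ∧ b = 0 ∧ d₁ = 0 ∧ d₂ = 0 ∧ d₄ = 0 ∧ e₁ = 0 ∧ e₂ = 0 ∧ e₄ = 0) ∨
    (β = -2 / (n : ℝ) ∧ b = ((n : ℝ) - 1) * a / n ^ 2 ∧ d₂ = d₁ + a ∧
      d₄ = d₁ - (((n : ℝ) - 2) / n) * a - μ ∧
      e₁ = (((n : ℝ) + 2) * (d₁ + a) - μ) / (n - 1) ∧
      e₂ = (((n : ℝ) + 2) * d₁ + (2 + 1 / (n : ℝ)) * a - μ) / (n - 1) ∧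
      e₄ = (-(((n : ℝ) + 2) * d₁) - ((n : ℝ) + 2 / n) * a + n * μ) / (n - 1)) := by
  have hN : (2 : ℝ) ≤ (n : ℝ) := by exact_mod_cast hn
  generalize (n : ℝ) = N at *
  have hN0 : N ≠ 0 := by linarith
  have hN1 : N - 1 ≠ 0 := by intro h; linarith
  obtain ⟨t, ht⟩ : ∃ t, t = N * β + 2 := ⟨_, rfl⟩
  have hβ : β = (t - 2) / N := by rw [ht]; field_simp; ring
  clear ht
  subst hβ
  field_simp at hΔ₁ hΔ₂ hΔ₄ hΘ₁ hΘ₂ hΞ₁ hΞ₂ hΞ₄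
  have h4 : d₄ = -(t-1)*d₁ - (t+N-2)*a - μ + N*(t+N-2)*b := by
    linear_combination hΔ₁ - hΞ₁
  have E1 : (N-1)*e₁ = (N+2)*d₁ - μ + 3*a + N*(t+N)*b := by linear_combination -hΞ₁
  have E2 : (N-1)*e₂ = (N+2)*d₂ - μ - N*(N+1)*b := by linear_combination -hΞ₂
  have E4 : (N-1)*e₄ = -(N+2)*d₄ + (t-2)*μ - 2*N*(N+1)*b := by linear_combination hΞ₄
  have A : t*d₂ - t*d₁ - (t+2*N-2)*a + N*(t+2*N)*b = 0 := by
    linear_combination hΔ₂ - hΞ₂ - h4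
  have B : (t-2)*(-t*d₁ - (t+N-1)*a + N*(t+N)*b) = 0 := by
    linear_combination hΔ₄ - hΞ₄ - (t-1)*h4
  have C : t*(2*(N+2)*d₁ + 6*a + N*(t+N-2)*b) = 0 := by
    linear_combination (N-1)*hΘ₁ - (t+N)*E1 - E4 + (N+2)*h4
  have D' : (N+2)*(-2*d₁ + (2*t+2)*d₂ - 2*a - N*t*b) = 0 := by
    linear_combination (N-1)*hΘ₂ + E1 - (t+N+1)*E2 - E4 + (N+2)*h4 + (N+2)*A
  have D : -2*d₁ + (2*t+2)*d₂ - 2*a - N*t*b = 0 :=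
    (mul_eq_zero.mp D').resolve_left (by linarith)
  clear hΔ₁ hΔ₂ hΔ₄ hΘ₁ hΘ₂ hΞ₁ hΞ₂ hΞ₄ D'
  by_cases ht : t = 0
  · right
    subst ht
    have hd : d₂ = d₁ + a := by linear_combination D / 2
    have hb : b = (N-1)*a/N^2 := by
      rw [eq_div_iff (by positivity)]; linear_combination A / 2
    have hb' : N*b = (N-1)*a/N := by rw [hb]; field_simp
    refine ⟨by ring, hb, hd, ?_, ?_, ?_, ?_⟩
    · rw [h4, hb]; field_simp; ring
    · rw [eq_div_iff hN1, mul_comm, E1, hb]; field_simp; ring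
    · rw [eq_div_iff hN1, mul_comm, E2, hb, hd]; field_simp; ring
    · rw [eq_div_iff hN1, mul_comm, E4, h4, hb]; field_simp; ring
  · left
    have C' := (mul_eq_zero.mp C).resolve_left ht
    have key : 2*(N-1)*a = N*(t+2*N)*b := by
      rcases mul_eq_zero.mp B with h | h
      · have h2 : t = 2 := by linarith
        subst h2
        have : (3*N+8) * (2*(N-1)*a - N*(2+2*N)*b) = 0 := by
          linear_combination -2 * (C' + (N+2)/2*(-D + 3*A))
        have := (mul_eq_zero.mp this).resolve_left (by linarith)
        linarith
      · have k1 : (t+2)*(2*(N-1)*a - N*(t+2*N)*b) = 0 := by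
          linear_combination t*D - (2*t+2)*A + 2*t*h
        have k2 : (t+N+2)*(2*(N-1)*a - N*(t+2*N)*b) = 0 := by
          linear_combination -C - 2*(N+2)*h
        have k3 : N*(2*(N-1)*a - N*(t+2*N)*b) = 0 := by linear_combination k2 - k1
        have := (mul_eq_zero.mp k3).resolve_left hN0
        linarith
    have hd : d₂ = N*b/2 := by
      have h0 : t * (d₂ - d₁ - a) = 0 := by linear_combination A + key
      have h1 := (mul_eq_zero.mp h0).resolve_left ht
      have : t * (2*d₂ - N*b) = 0 := by linear_combination D - 2*h1
      have := (mul_eq_zero.mp this).resolve_left ht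
      linarith
    have hb : b = 0 := by
      have h1 : 0 ≤ (N-1)*(d₂*e₂) := mul_nonneg (by linarith) hs₂
      have h2 : (N-1)*(d₂*e₂) = -(N^3*b^2/4) - d₂*μ := by
        linear_combination d₂*E2 + ((N+2)*d₂ + (N+2)*N*b/2 - N*(N+1)*b)*hd
      have h3 : N^3*b^2 ≤ 0 := by linarith
      have h4 : 0 < N^3 := by positivity
      have h5 : b^2 ≤ 0 := by nlinarith
      nlinarith
    subst hb
    have ha : a = 0 := by
      have : (N-1)*a = 0 := by linarith
      exact (mul_eq_zero.mp this).resolve_left hN1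
    have hd2 : d₂ = 0 := by rw [hd]; ring
    subst ha hd2
    have hd1 : d₁ = 0 := by linarith
    subst hd1
    have hμ : μ = 0 := by
      have h1 : 0 ≤ (N-1)*(e₂*μ) := mul_nonneg (by linarith) hs₄
      have h2 : (N-1)*(e₂*μ) = -μ^2 := by linear_combination μ*E2
      nlinarith
    subst hμ
    have hd4 : d₄ = 0 := by rw [h4]; ring
    subst hd4
    refine ⟨rfl, rfl, rfl, rfl, rfl, rfl, ?_, ?_, ?_⟩
    · exact (mul_eq_zero.mp (E1.trans (by ring))).resolve_left hN1
    · exact (mul_eq_zero.mp (E2.trans (by ring))).resolve_left hN1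
    · exact (mul_eq_zero.mp (E4.trans (by ring))).resolve_left hN1
end

section
/- Let β, μ, b, d₁, d₂, d₄ be real numbers satisfying the six equations: (β+4)d₁ + d₄ + 2b = 0; −d₁ + (β+5)d₂ + d₄ + b = 0; d₁ + (β+4)d₄ + μ + (β+3)b = 0; 3d₁ − μ + (β+3)b = 0; 3d₂ − μ − 2b = 0; 3d₄ − βμ + 4b = 0. Then either d₁ = d₂ = d₄ = μ = b = 0, or β = −2, b = 0, d₁ = d₂ = μ/3 and d₄ = −2μ/3. -/
theorem jerison_lee_classification_n1 (β μ b d₁ d₂ d₄ : ℝ)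
    (h1 : (β + 4) * d₁ + d₄ + 2 * b = 0)
    (h2 : -d₁ + (β + 5) * d₂ + d₄ + b = 0)
    (h3 : d₁ + (β + 4) * d₄ + μ + (β + 3) * b = 0)
    (h4 : 3 * d₁ - μ + (β + 3) * b = 0)
    (h5 : 3 * d₂ - μ - 2 * b = 0)
    (h6 : 3 * d₄ - β * μ + 4 * b = 0) :
    (d₁ = 0 ∧ d₂ = 0 ∧ d₄ = 0 ∧ μ = 0 ∧ b = 0) ∨
    (β = -2 ∧ b = 0 ∧ d₁ = μ / 3 ∧ d₂ = μ / 3 ∧ d₄ = -(2 * μ) / 3) := by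
  have e1 : (β + 2) * (2 * μ - (β + 5) * b) = 0 := by
    linear_combination 3 * h1 - (β + 4) * h4 - h6
  have e2 : (2 * β + 4) * μ + (3 * β + 12) * b = 0 := by
    linear_combination 3 * h2 + h4 - (β + 5) * h5 - h6
  have e3 : (β + 2) ^ 2 * μ - (2 * β + 10) * b = 0 := by
    linear_combination 3 * h3 - h4 - (β + 4) * h6
  rcases mul_eq_zero.mp e1 with h | h
  · right
    have hβ : β = -2 := by linarith
    subst hβ
    have hb : b = 0 := by linarith
    subst hb
    refine ⟨rfl, rfl, ?_, ?_, ?_⟩ <;> linarith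
  · left
    have f1 : b * (β ^ 2 + 10 * β + 22) = 0 := by
      linear_combination e2 - (β + 2) * h
    have f2 : b * ((β + 5) * (β * (β + 4))) = 0 := by
      linear_combination 2 * e3 - (β + 2) ^ 2 * h
    have hb : b = 0 := by
      by_contra hb
      have g1 := (mul_eq_zero.mp f1).resolve_left hb
      have g2 := (mul_eq_zero.mp f2).resolve_left hb
      rcases mul_eq_zero.mp g2 with g | g
      · have hβ : β = -5 := by linarith
        subst hβ
        norm_num at g1
      · rcases mul_eq_zero.mp g with g | g
        · subst g
          norm_num at g1
        · have hβ : β = -4 := by linarith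
          subst hβ
          norm_num at g1
    subst hb
    have hm : μ = 0 := by linarith
    subst hm
    refine ⟨?_, ?_, ?_, rfl, rfl⟩ <;> linarith
end

section
/- Let n ≥ 2 be an integer and let d₁, a be real numbers. If the real symmetric 3×3 matrix [[0, (−d₁ + ((n−2)/n)a)/2, ((n+2)d₁ + (n + 2/n)a)/(2(n−1))], [(−d₁ + ((n−2)/n)a)/2, 2(d₁ + a), ((2n+1)d₁ + 3a)/(2(n−1))], [((n+2)d₁ + (n + 2/n)a)/(2(n−1)), ((2n+1)d₁ + 3a)/(2(n−1)), ((2n−1)/(n−1)²)·((n+2)d₁ + ((n²+5n−3)/(2n−1))a)]] is positive semidefinite, then d₁ = 0 and a = 0. -/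
theorem psd_zero_corner (b c d e f : ℝ)
    (h : (!![0, b, c; b, d, e; c, e, f] : Matrix (Fin 3) (Fin 3) ℝ).PosSemidef) :
    b = 0 ∧ c = 0 := by
  have key : ∀ p q : ℝ, (∀ t : ℝ, 0 ≤ 2 * t * p + q) → p = 0 := by
    intro p q H
    by_contra hp
    have h1 := H (-(q + 1) / (2 * p))
    have h2 : 2 * (-(q + 1) / (2 * p)) * p = -(q + 1) := by field_simp
    linarith
  constructor
  · refine key b d fun t => ?_
    have := h.dotProduct_mulVec_nonneg ![t, 1, 0]
    simp [Matrix.mulVec, dotProduct, Fin.sum_univ_three] at this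
    linarith
  · refine key c f fun t => ?_
    have := h.dotProduct_mulVec_nonneg ![t, 0, 1]
    simp [Matrix.mulVec, dotProduct, Fin.sum_univ_three] at this
    linarith

theorem no_positive_identity_mu_zero (n : ℕ) (hn : 2 ≤ n) (d₁ a : ℝ)
    (h : (!![0, (-d₁ + (((n : ℝ) - 2) / n) * a) / 2,
            (((n : ℝ) + 2) * d₁ + ((n : ℝ) + 2 / n) * a) / (2 * ((n : ℝ) - 1));
          (-d₁ + (((n : ℝ) - 2) / n) * a) / 2, 2 * (d₁ + a),
            ((2 * (n : ℝ) + 1) * d₁ + 3 * a) / (2 * ((n : ℝ) - 1));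
          (((n : ℝ) + 2) * d₁ + ((n : ℝ) + 2 / n) * a) / (2 * ((n : ℝ) - 1)),
            ((2 * (n : ℝ) + 1) * d₁ + 3 * a) / (2 * ((n : ℝ) - 1)),
            ((2 * (n : ℝ) - 1) / ((n : ℝ) - 1) ^ 2) *
              (((n : ℝ) + 2) * d₁ + (((n : ℝ) ^ 2 + 5 * n - 3) / (2 * (n : ℝ) - 1)) * a)] :
        Matrix (Fin 3) (Fin 3) ℝ).PosSemidef) :
    d₁ = 0 ∧ a = 0 := by
  obtain ⟨h1, h2⟩ := psd_zero_corner _ _ _ _ _ h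
  have hn' : (2 : ℝ) ≤ n := by exact_mod_cast hn
  generalize (n : ℝ) = x at *
  have hx : x ≠ 0 := by linarith
  have hx1 : x - 1 ≠ 0 := by intro h; linarith
  have e1 : d₁ = (x - 2) / x * a := by linarith
  have e2 : (x + 2) * d₁ + (x + 2 / x) * a = 0 := by
    rcases div_eq_zero_iff.mp h2 with h | h
    · exact h
    · exact absurd (by linarith) hx1
  have e3 : (2 * (x ^ 2 - 1)) * a = 0 := by
    rw [e1] at e2
    field_simp at e2
    linear_combination e2
  have ha : a = 0 := by
    rcases mul_eq_zero.mp e3 with h | h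
    · nlinarith
    · exact h
  exact ⟨by rw [e1, ha, mul_zero], ha⟩
end
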